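/- arXiv:1002.3970 — 4 statements merged into one kernel-verified Lean document; each statement's English description precedes it below -/
import Mathlib

section
/- There exist universal constants C, c > 0 such that the following holds. Let n ≥ 1, let 𝒥 ⊆ {1,…,n} be a subset of cardinality k = #(𝒥) with k ≥ 4n/5, and let Θ = (Θ₁,…,Θₙ) be a random vector distributed uniformly on S^{n−1}. Then with probability at least 1 − C·exp(−cn), one has Σ_{j ∈ 𝒮} Θⱼ² ≥ 1/8, where 𝒮 = {j ∈ 𝒥 : |Θⱼ| ≤ 40/√n}. -/
open MeasureTheory ProbabilityTheory Real

noncomputable section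

/-- The image of a point of the unit sphere under a linear isometry of `ℝⁿ`. -/
def rotateSphere {n : ℕ} (e : EuclideanSpace ℝ (Fin n) ≃ₗᵢ[ℝ] EuclideanSpace ℝ (Fin n))
    (x : Metric.sphere (0 : EuclideanSpace ℝ (Fin n)) 1) :
    Metric.sphere (0 : EuclideanSpace ℝ (Fin n)) 1 :=
  ⟨e x, by
    rw [mem_sphere_zero_iff_norm, e.norm_map, ← mem_sphere_zero_iff_norm]
    exact x.2⟩

/-- `σ` is the uniform probability measure on the unit sphere `S^{n-1}`, i.e. the unique
rotation-invariant probability measure on the sphere. -/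
def IsUniformSphereMeasure {n : ℕ}
    (σ : Measure (Metric.sphere (0 : EuclideanSpace ℝ (Fin n)) 1)) : Prop :=
  IsProbabilityMeasure σ ∧
    ∀ e : EuclideanSpace ℝ (Fin n) ≃ₗᵢ[ℝ] EuclideanSpace ℝ (Fin n),
      Measure.map (rotateSphere e) σ = σ

lemma exists_linearIsometryEquiv_of_norm_eq {E : Type*} [NormedAddCommGroup E]
    [InnerProductSpace ℝ E] [CompleteSpace E] {v w : E} (h : ‖v‖ = ‖w‖) :
    ∃ e : E ≃ₗᵢ[ℝ] E, e v = w :=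
  ⟨_, Submodule.reflection_sub h⟩

/-- The characteristic function of a rotation-invariant measure is radial. -/
lemma charFun_eq_of_norm_eq {E : Type*} [NormedAddCommGroup E] [InnerProductSpace ℝ E]
    [CompleteSpace E] [MeasurableSpace E] [BorelSpace E] {μ : Measure E}
    (hμ : ∀ e : E ≃ₗᵢ[ℝ] E, μ.map e = μ) {v w : E} (h : ‖v‖ = ‖w‖) :
    charFun μ v = charFun μ w := by
  obtain ⟨e, rfl⟩ := exists_linearIsometryEquiv_of_norm_eq h
  conv_rhs => rw [← hμ e]
  rw [charFun_apply, charFun_apply, integral_map (by fun_prop) (by fun_prop)]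
  simp

/-- A rotation-invariant probability measure carried by the unit sphere is unique. -/
lemma eq_of_map_linearIsometryEquiv_eq {E : Type*} [NormedAddCommGroup E] [InnerProductSpace ℝ E]
    [CompleteSpace E] [SecondCountableTopology E] [MeasurableSpace E] [BorelSpace E]
    {μ τ : Measure E} [IsProbabilityMeasure μ] [IsProbabilityMeasure τ]
    (hμ : ∀ e : E ≃ₗᵢ[ℝ] E, μ.map e = μ) (hτ : ∀ e : E ≃ₗᵢ[ℝ] E, τ.map e = τ)
    (hμ1 : ∀ᵐ x ∂μ, ‖x‖ = 1) (hτ1 : ∀ᵐ x ∂τ, ‖x‖ = 1) : μ = τ := by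
  have key : ∀ {α β : Measure E} [IsProbabilityMeasure α] [IsProbabilityMeasure β],
      (∀ e : E ≃ₗᵢ[ℝ] E, α.map e = α) → (∀ᵐ x ∂β, ‖x‖ = 1) → ∀ t : E,
      charFun α t = ∫ y, ∫ x, Complex.exp (inner ℝ x (‖t‖ • y) * Complex.I) ∂α ∂β := by
    intro α β _ _ hα hβ t
    have : (fun y ↦ ∫ x, Complex.exp (inner ℝ x (‖t‖ • y) * Complex.I) ∂α)
        =ᵐ[β] fun _ ↦ charFun α t := by
      filter_upwards [hβ] with y hy
      rw [← charFun_apply]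
      exact charFun_eq_of_norm_eq hα (by simp [norm_smul, hy])
    rw [integral_congr_ae this]
    simp
  refine Measure.ext_of_charFun (funext fun t ↦ ?_)
  rw [key hμ hτ1 t, key hτ hμ1 t, integral_integral_swap]
  · simp only [real_inner_smul_right, real_inner_comm]
  · refine Integrable.of_bound (C := 1) (Measurable.aestronglyMeasurable ?_) (ae_of_all _ fun p ↦ ?_)
    · unfold Function.uncurry; fun_prop
    · simp [Function.uncurry, Complex.norm_exp_ofReal_mul_I]

lemma stdGaussian_singleton_zero {ι : Type*} [Fintype ι] [Nonempty ι] :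
    stdGaussian (EuclideanSpace ℝ ι) {0} = 0 := by
  rw [← map_pi_eq_stdGaussian, Measure.map_apply (by fun_prop) (measurableSet_singleton _)]
  have : (WithLp.toLp 2 : (ι → ℝ) → EuclideanSpace ℝ ι) ⁻¹' {0} = {0} := by
    ext x; simp
  rw [this, Measure.pi_singleton]
  have := nullSingletonClass_gaussianReal (μ := 0) (v := 1) one_ne_zero
  simp

/-- The uniform measure on the sphere is the law of a normalized standard Gaussian vector. -/
lemma IsUniformSphereMeasure.map_val_eq {n : ℕ} (hn : 1 ≤ n)
    {σ : Measure (Metric.sphere (0 : EuclideanSpace ℝ (Fin n)) 1)}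
    (hσ : IsUniformSphereMeasure σ) :
    σ.map Subtype.val =
      (stdGaussian (EuclideanSpace ℝ (Fin n))).map (fun x ↦ ‖x‖⁻¹ • x) := by
  have := hσ.1
  have : Nonempty (Fin n) := ⟨⟨0, hn⟩⟩
  have hm : Measurable fun x : EuclideanSpace ℝ (Fin n) ↦ ‖x‖⁻¹ • x := by fun_prop
  have : IsProbabilityMeasure (σ.map Subtype.val) :=
    Measure.isProbabilityMeasure_map (by fun_prop)
  have : IsProbabilityMeasure
      ((stdGaussian (EuclideanSpace ℝ (Fin n))).map (fun x ↦ ‖x‖⁻¹ • x)) :=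
    Measure.isProbabilityMeasure_map (by fun_prop)
  refine eq_of_map_linearIsometryEquiv_eq (fun e ↦ ?_) (fun e ↦ ?_) ?_ ?_
  · have hr : Measurable (rotateSphere e) := by
      refine Measurable.subtype_mk ?_
      exact e.continuous.measurable.comp measurable_subtype_coe
    conv_rhs => rw [← hσ.2 e]
    rw [Measure.map_map e.continuous.measurable measurable_subtype_coe,
      Measure.map_map measurable_subtype_coe hr]
    rfl
  · conv_rhs => rw [← stdGaussian_map e]
    rw [Measure.map_map e.continuous.measurable hm, Measure.map_map hm e.continuous.measurable]
    congr 1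
    ext1 x
    simp
  · rw [ae_map_iff (by fun_prop) (measurableSet_eq_fun (by fun_prop) (by fun_prop))]
    exact ae_of_all _ fun x ↦ by simp
  · rw [ae_map_iff (by fun_prop) (measurableSet_eq_fun (by fun_prop) (by fun_prop))]
    have h0 : ∀ᵐ x ∂(stdGaussian (EuclideanSpace ℝ (Fin n))), x ≠ 0 := by
      simpa [ae_iff] using stdGaussian_singleton_zero (ι := Fin n)
    filter_upwards [h0] with x hx
    simp [norm_smul, hx]

lemma exp_mul_sq_mul_gaussianPDFReal (a x : ℝ) :
    gaussianPDFReal 0 1 x * exp (a * x ^ 2) = (√(2 * π))⁻¹ * exp (-(1 / 2 - a) * x ^ 2) := by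
  simp only [gaussianPDFReal, NNReal.coe_one, mul_one, sub_zero]
  rw [mul_assoc, ← Real.exp_add]
  ring_nf

lemma integrable_exp_mul_sq_gaussianReal {a : ℝ} (ha : a < 1 / 2) :
    Integrable (fun x ↦ exp (a * x ^ 2)) (gaussianReal 0 1) := by
  rw [gaussianReal_of_var_ne_zero _ one_ne_zero, gaussianPDF_def,
    integrable_withDensity_iff_integrable_smul₀' (by fun_prop) (by simp)]
  simp only [smul_eq_mul, ENNReal.toReal_ofReal (gaussianPDFReal_nonneg _ _ _),
    exp_mul_sq_mul_gaussianPDFReal]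
  exact (integrable_exp_neg_mul_sq (by linarith)).const_mul _

lemma integral_exp_mul_sq_gaussianReal {a : ℝ} (ha : a < 1 / 2) :
    ∫ x, exp (a * x ^ 2) ∂(gaussianReal 0 1) = √(1 / (1 - 2 * a)) := by
  rw [integral_gaussianReal_eq_integral_smul one_ne_zero]
  simp only [smul_eq_mul, exp_mul_sq_mul_gaussianPDFReal]
  rw [integral_const_mul, integral_gaussian, ← Real.sqrt_inv, ← Real.sqrt_mul (by positivity)]
  congr 1
  have : 1 - 2 * a ≠ 0 := by linarith
  have : 1 / 2 - a ≠ 0 := by linarith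
  have := Real.pi_ne_zero
  field_simp

/-- Chernoff bound for a product measure. -/
lemma measureReal_one_le_prod_le {n : ℕ} {μ : Measure ℝ} [IsProbabilityMeasure μ]
    {f : Fin n → ℝ → ℝ} (hf : ∀ i, Integrable (f i) μ) (hf0 : ∀ i x, 0 ≤ f i x)
    {r : Fin n → ℝ} (hr : ∀ i, ∫ x, f i x ∂μ ≤ exp (r i)) :
    (Measure.pi fun _ : Fin n ↦ μ).real {x | 1 ≤ ∏ i, f i (x i)} ≤ exp (∑ i, r i) := by
  have h := mul_meas_ge_le_integral_of_nonneg (μ := Measure.pi fun _ : Fin n ↦ μ)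
    (f := fun x ↦ ∏ i, f i (x i)) (ae_of_all _ fun x ↦ Finset.prod_nonneg fun i _ ↦ hf0 i _)
    (Integrable.fintype_prod hf) 1
  rw [one_mul, integral_fintype_prod_eq_prod] at h
  rw [Real.exp_sum]
  exact h.trans (Finset.prod_le_prod (fun i _ ↦ integral_nonneg (hf0 i)) fun i _ ↦ hr i)

/-- A standard Gaussian vector rarely has squared norm below `n / 16`. -/
lemma measureReal_pi_gaussian_sum_sq_le (n : ℕ) :
    (Measure.pi fun _ : Fin n ↦ gaussianReal 0 1).real {x | ∑ i, x i ^ 2 ≤ n / 16} ≤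
      exp (-(1 / 5) * n) := by
  have hi := (integrable_exp_mul_sq_gaussianReal (a := -1) (by norm_num)).const_mul (exp (1 / 16))
  have h := measureReal_one_le_prod_le (n := n) (μ := gaussianReal 0 1)
    (f := fun _ x ↦ exp (1 / 16) * exp (-1 * x ^ 2)) (fun _ ↦ hi) (fun _ _ ↦ by positivity)
    (r := fun _ ↦ -(1 / 5)) (fun _ ↦ by
      rw [integral_const_mul, integral_exp_mul_sq_gaussianReal (by norm_num)]
      have h1 : exp (1 / 16) * exp (1 / 5) ≤ 8 / 5 := by
        rw [← Real.exp_add]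
        have := Real.add_one_le_exp (-(1 / 16 + 1 / 5) : ℝ)
        have h2 : exp (-(1 / 16 + 1 / 5)) * exp (1 / 16 + 1 / 5) = 1 := by
          rw [← Real.exp_add]; simp
        nlinarith [Real.exp_pos (1 / 16 + 1 / 5 : ℝ)]
      have h3 : √(1 / (1 - 2 * (-1))) ≤ (5 / 8 : ℝ) := by
        rw [Real.sqrt_le_left (by norm_num)]; norm_num
      have h4 : exp (-(1 / 5)) * exp (1 / 5) = 1 := by rw [← Real.exp_add]; simp
      refine le_of_mul_le_mul_right ?_ (Real.exp_pos (1 / 5))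
      rw [h4, mul_right_comm]
      calc _ ≤ (8 / 5 : ℝ) * (5 / 8) := by gcongr
        _ = 1 := by norm_num)
  refine (measureReal_mono fun x hx ↦ ?_).trans (h.trans_eq (by simp [mul_comm]))
  simp only [Set.mem_ofPred_eq] at hx ⊢
  simp_rw [← Real.exp_add, ← Real.exp_sum]
  refine Real.one_le_exp ?_
  rw [Finset.sum_add_distrib, ← Finset.mul_sum]
  simp
  linarith

/-- The coordinates in `𝒥` that are at most `10` rarely carry less than an eighth of the squared
norm of a standard Gaussian vector. -/
lemma measureReal_pi_gaussian_small_coord_le {n : ℕ} {𝒥 : Finset (Fin n)}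
    (h𝒥 : 4 * (n : ℝ) / 5 ≤ 𝒥.card) :
    (Measure.pi fun _ : Fin n ↦ gaussianReal 0 1).real
      {x | ∑ i ∈ 𝒥 with |x i| ≤ 10, x i ^ 2 ≤ (∑ i, x i ^ 2) / 8} ≤ exp (-(1 / 5) * n) := by
  have hu := integrable_exp_mul_sq_gaussianReal (a := 1 / 8) (by norm_num)
  have hv₁ := integrable_exp_mul_sq_gaussianReal (a := -(7 / 8)) (by norm_num)
  have hv₂ := (integrable_exp_mul_sq_gaussianReal (a := 1 / 4) (by norm_num)).const_mul
    (exp (-(25 / 2)))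
  have hU : ∫ x, exp (1 / 8 * x ^ 2) ∂(gaussianReal 0 1) ≤ exp (1 / 5) := by
    rw [integral_exp_mul_sq_gaussianReal (by norm_num)]
    have h1 : √(1 / (1 - 2 * (1 / 8))) ≤ (6 / 5 : ℝ) := by
      rw [Real.sqrt_le_left (by norm_num)]; norm_num
    linarith [Real.add_one_le_exp (1 / 5 : ℝ)]
  have hV : ∫ x, (exp (-(7 / 8) * x ^ 2) + exp (-(25 / 2)) * exp (1 / 4 * x ^ 2))
      ∂(gaussianReal 0 1) ≤ exp (-(2 / 5)) := by
    rw [integral_add hv₁ hv₂, integral_const_mul, integral_exp_mul_sq_gaussianReal (by norm_num),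
      integral_exp_mul_sq_gaussianReal (by norm_num)]
    have h1 : √(1 / (1 - 2 * (-(7 / 8)))) ≤ (61 / 100 : ℝ) := by
      rw [Real.sqrt_le_left (by norm_num)]; norm_num
    have h2 : √(1 / (1 - 2 * (1 / 4))) ≤ (3 / 2 : ℝ) := by
      rw [Real.sqrt_le_left (by norm_num)]; norm_num
    have h3 : exp (-(25 / 2)) ≤ (1 / 90 : ℝ) := by
      rw [Real.exp_neg, one_div]
      have := Real.quadratic_le_exp_of_nonneg (x := 25 / 2) (by norm_num)
      gcongr
      linarith
    have h4 : (16 / 25 : ℝ) ≤ exp (-(2 / 5)) := by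
      rw [show (-(2 / 5) : ℝ) = -(1 / 5) + -(1 / 5) by norm_num, Real.exp_add]
      nlinarith [Real.add_one_le_exp (-(1 / 5) : ℝ)]
    have h5 : exp (-(25 / 2)) * √(1 / (1 - 2 * (1 / 4))) ≤ (1 / 90 : ℝ) * (3 / 2) := by gcongr
    linarith
  have h := measureReal_one_le_prod_le (n := n) (μ := gaussianReal 0 1)
    (f := fun i x ↦ if i ∈ 𝒥 then exp (-(7 / 8) * x ^ 2) + exp (-(25 / 2)) * exp (1 / 4 * x ^ 2)
      else exp (1 / 8 * x ^ 2))
    (fun i ↦ by split_ifs; exacts [hv₁.add hv₂, hu])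
    (fun i x ↦ by split_ifs <;> positivity)
    (r := fun i ↦ 1 / 5 - if i ∈ 𝒥 then 3 / 5 else 0)
    (fun i ↦ by
      split_ifs
      · exact hV.trans_eq (by norm_num)
      · simpa using hU)
  refine (measureReal_mono fun x hx ↦ ?_).trans (h.trans ?_)
  · simp only [Set.mem_ofPred_eq] at hx ⊢
    have hp : ∀ i, exp (x i ^ 2 / 8 - if i ∈ 𝒥 then if |x i| ≤ 10 then x i ^ 2 else 0 else 0) ≤
        if i ∈ 𝒥 then exp (-(7 / 8) * x i ^ 2) + exp (-(25 / 2)) * exp (1 / 4 * x i ^ 2)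
          else exp (1 / 8 * x i ^ 2) := by
      intro i
      split_ifs with h1 h2
      · refine le_add_of_le_of_nonneg (Real.exp_le_exp.2 (by linarith)) (by positivity)
      · refine le_add_of_nonneg_of_le (by positivity) ?_
        rw [← Real.exp_add, Real.exp_le_exp]
        have : (10 : ℝ) ^ 2 ≤ |x i| ^ 2 := by gcongr; exact (not_le.1 h2).le
        rw [sq_abs] at this
        linarith
      · exact Real.exp_le_exp.2 (by linarith)
    refine le_trans ?_ (Finset.prod_le_prod (fun i _ ↦ (Real.exp_pos _).le) fun i _ ↦ hp i)
    rw [← Real.exp_sum, Finset.sum_sub_distrib, ← Finset.sum_div]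
    refine Real.one_le_exp ?_
    rw [Finset.sum_ite_mem, Finset.univ_inter, ← Finset.sum_filter]
    linarith
  · rw [Finset.sum_sub_distrib]
    simp
    linarith

/-- On the rare event that `Θ` has little mass on its small coordinates in `𝒥`, a Gaussian vector
in the direction `Θ` is atypical. -/
lemma stdGaussian_spread_mass_lt_le {n : ℕ} (hn : 1 ≤ n) {𝒥 : Finset (Fin n)}
    (h𝒥 : 4 * (n : ℝ) / 5 ≤ 𝒥.card) :
    (stdGaussian (EuclideanSpace ℝ (Fin n))).real
      {x | ∑ j ∈ 𝒥 with |(‖x‖⁻¹ • x) j| ≤ 40 / √n, (‖x‖⁻¹ • x) j ^ 2 < 1 / 8} ≤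
      2 * exp (-(1 / 5) * n) := by
  have hn0 : (0 : ℝ) < n := by exact_mod_cast hn
  rw [← map_pi_eq_stdGaussian, ← MeasurableEquiv.coe_toLp, measureReal_def,
    MeasurableEquiv.map_apply, ← measureReal_def]
  refine (measureReal_mono (fun x hx ↦ ?_)).trans <| (measureReal_union_le _ _).trans <|
    (add_le_add (measureReal_pi_gaussian_sum_sq_le n)
      (measureReal_pi_gaussian_small_coord_le h𝒥)).trans_eq (two_mul _).symm
  rw [Set.mem_union, or_iff_not_imp_left]
  intro hx1
  simp only [Set.mem_ofPred_eq, not_le, Set.mem_preimage, MeasurableEquiv.coe_toLp] at hx hx1 ⊢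
  set r : ℝ := ‖(WithLp.toLp 2 x : EuclideanSpace ℝ (Fin n))‖
  have hr2 : r ^ 2 = ∑ i, x i ^ 2 := EuclideanSpace.real_norm_sq_eq _
  rw [← hr2] at hx1 ⊢
  have hr : √n / 4 ≤ r := by
    refine (sq_le_sq₀ (by positivity) (norm_nonneg _)).1 ?_
    rw [div_pow, Real.sq_sqrt hn0.le]
    linarith
  have hs : 0 < √(n : ℝ) := Real.sqrt_pos.2 hn0
  have hr0 : 0 < r := by linarith
  simp only [PiLp.smul_apply, smul_eq_mul, mul_pow, ← Finset.mul_sum] at hx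
  rw [inv_pow, inv_mul_lt_iff₀ (by positivity)] at hx
  refine le_trans (Finset.sum_le_sum_of_subset_of_nonneg ?_ fun _ _ _ ↦ sq_nonneg _)
    (hx.le.trans_eq (by ring))
  refine Finset.monotone_filter_right _ fun i _ hi ↦ ?_
  rw [abs_mul, abs_inv, abs_of_pos hr0, inv_mul_le_iff₀ hr0, mul_div_assoc', le_div_iff₀ hs]
  calc |x i| * √n ≤ 10 * √n := by gcongr
    _ ≤ r * 40 := by linarith

/-- **Lemma 3.2 (Klartag–Sodin).** If `𝒥 ⊆ {1,…,n}` has cardinality at least `4n/5`, then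
with probability at least `1 − C exp(−cn)` over a uniform `Θ ∈ S^{n−1}`, the coordinates
`j ∈ 𝒥` with `|Θⱼ| ≤ 40/√n` carry at least `1/8` of the total mass. -/
theorem random_direction_spread_mass :
    ∃ C c : ℝ, 0 < C ∧ 0 < c ∧
      ∀ (n : ℕ), 1 ≤ n →
      ∀ 𝒥 : Finset (Fin n), (4 * (n : ℝ) / 5 ≤ 𝒥.card) →
      ∀ σ : Measure (Metric.sphere (0 : EuclideanSpace ℝ (Fin n)) 1),
        IsUniformSphereMeasure σ →
        ENNReal.ofReal (1 - C * Real.exp (-c * n)) ≤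
          σ {θ | 1 / 8 ≤ ∑ j ∈ 𝒥.filter
              (fun j => |(θ : EuclideanSpace ℝ (Fin n)) j| ≤ 40 / Real.sqrt n),
            (θ : EuclideanSpace ℝ (Fin n)) j ^ 2} := by
  refine ⟨2, 1 / 5, by norm_num, by norm_num, fun n hn 𝒥 h𝒥 σ hσ ↦ ?_⟩
  have := hσ.1
  have hm : Measurable fun x : EuclideanSpace ℝ (Fin n) ↦
      ∑ j ∈ 𝒥 with |x j| ≤ 40 / √n, x j ^ 2 := by
    simp_rw [Finset.sum_filter]
    refine Finset.measurable_sum _ fun j _ ↦ Measurable.ite ?_ (by fun_prop) measurable_const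
    exact measurableSet_le (by fun_prop) measurable_const
  have hbad : MeasurableSet {x : EuclideanSpace ℝ (Fin n) |
      ∑ j ∈ 𝒥 with |x j| ≤ 40 / √n, x j ^ 2 < 1 / 8} := measurableSet_lt hm measurable_const
  have h := stdGaussian_spread_mass_lt_le hn h𝒥
  have hlaw := congrArg (fun μ ↦ μ.real {x : EuclideanSpace ℝ (Fin n) |
      ∑ j ∈ 𝒥 with |x j| ≤ 40 / √n, x j ^ 2 < 1 / 8}) (hσ.map_val_eq hn)
  simp only [map_measureReal_apply measurable_subtype_coe hbad,
    map_measureReal_apply (show Measurable fun x : EuclideanSpace ℝ (Fin n) ↦ ‖x‖⁻¹ • x by fun_prop)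
      hbad] at hlaw
  have hc := probReal_compl_eq_one_sub (μ := σ) (hbad.preimage measurable_subtype_coe)
  rw [hlaw] at hc
  refine ENNReal.ofReal_le_of_le_toReal ?_
  change _ ≤ σ.real _
  convert (sub_le_sub_left h 1).trans_eq hc.symm using 2
  ext θ
  simp
end
end

section
/- There exists a universal constant c > 0 such that the following holds. Let X be a real random variable with E X = 0, E X² = 1 and E X⁴ = δ⁴ < ∞, let X̃ be an independent copy of X, and set Y = X − X̃. Let θ ∈ S^{n−1} and define S(ξ) = (E[d²(ξY/(2π)·θ, ℤⁿ)])^{1/2} for ξ ∈ ℝ. Then: (a) S(ξ₁ + ξ₂) ≤ S(ξ₁) + S(ξ₂) for all ξ₁, ξ₂ ∈ ℝ; and (b) if R ≥ 1 satisfies d(ξθ,ℤⁿ) ≥ (1/10)·min{|ξ|, (n/R)/|ξ|} for all |ξ| ≤ n (in particular if R = 𝒩(θ)), then for every ξ with |ξ| ≤ n/(Rδ⁴), S(ξ) ≥ c·min{|ξ|, (n/(Rδ⁴))/|ξ|}. -/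
open MeasureTheory ProbabilityTheory Real

noncomputable section

/-- The distance from a real number to the nearest integer: `d(x, ℤ) = min_{p ∈ ℤ} |p - x|`. -/
def distInt (x : ℝ) : ℝ := ⨅ p : ℤ, |(p : ℝ) - x|

/-- `d(v, ℤⁿ) = (∑ⱼ d²(vⱼ, ℤ))^{1/2}`. -/
def distIntVec {n : ℕ} (v : Fin n → ℝ) : ℝ := Real.sqrt (∑ j, distInt (v j) ^ 2)

/-- `R ≥ 1` witnesses the three arithmetic conditions (i), (ii), (iii) for a unit vector `θ`. -/
def IsArithGood {n : ℕ} (θ : Fin n → ℝ) (R : ℝ) : Prop :=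
  1 ≤ R ∧ |∑ j, θ j ^ 3| ≤ R / n ∧ (∑ j, θ j ^ 4) ≤ R / n ∧
    ∀ ξ : ℝ, |ξ| ≤ n →
      (1 / 10) * min |ξ| (((n : ℝ) / R) / |ξ|) ≤ distIntVec (fun j => ξ * θ j)

/-- `𝒩(θ)`: the minimal `R ≥ 1` satisfying the arithmetic conditions (i)–(iii). -/
def calN {n : ℕ} (θ : Fin n → ℝ) : ℝ := sInf {R | IsArithGood θ R}

theorem distInt_eq_norm (x : ℝ) : distInt x = ‖(x : UnitAddCircle)‖ := by
  rw [UnitAddCircle.norm_eq]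
  apply le_antisymm
  · rw [abs_sub_comm]
    exact ciInf_le ⟨0, by rintro _ ⟨p, rfl⟩; exact abs_nonneg _⟩ (round x)
  · refine le_ciInf fun p => ?_
    rw [abs_sub_comm (p : ℝ)]
    exact round_le x p

theorem distInt_nonneg (x : ℝ) : 0 ≤ distInt x := by
  rw [distInt_eq_norm]
  exact norm_nonneg _

theorem distInt_le_one (x : ℝ) : distInt x ≤ 1 := by
  rw [distInt_eq_norm, UnitAddCircle.norm_eq]
  linarith [abs_sub_round x]

theorem distInt_add_le (x y : ℝ) : distInt (x + y) ≤ distInt x + distInt y := by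
  simp only [distInt_eq_norm, AddCircle.coe_add]
  exact norm_add_le _ _

theorem continuous_distInt : Continuous distInt := by
  have h : distInt = fun x : ℝ => ‖(x : UnitAddCircle)‖ := funext distInt_eq_norm
  rw [h]
  exact (AddCircle.continuous_mk' 1).norm

theorem distIntVec_nonneg {n : ℕ} (v : Fin n → ℝ) : 0 ≤ distIntVec v := Real.sqrt_nonneg _

theorem continuous_distIntVec {n : ℕ} : Continuous (distIntVec (n := n)) := by
  unfold distIntVec
  have := continuous_distInt
  fun_prop

theorem distIntVec_le_sqrt {n : ℕ} (v : Fin n → ℝ) : distIntVec v ≤ √n := by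
  refine Real.sqrt_le_sqrt ?_
  calc ∑ j, distInt (v j) ^ 2 ≤ ∑ _j : Fin n, (1 : ℝ) :=
        Finset.sum_le_sum fun j _ => pow_le_one₀ (distInt_nonneg _) (distInt_le_one _)
    _ = n := by simp

theorem distIntVec_add_le {n : ℕ} (v w : Fin n → ℝ) :
    distIntVec (fun j => v j + w j) ≤ distIntVec v + distIntVec w := by
  have h (u : Fin n → ℝ) :
      distIntVec u = ‖WithLp.toLp 2 (fun j => distInt (u j))‖ := by
    simp [distIntVec, EuclideanSpace.norm_eq]
  have hmono : distIntVec (fun j => v j + w j) ≤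
      ‖WithLp.toLp 2 (fun j => distInt (v j) + distInt (w j))‖ := by
    rw [EuclideanSpace.norm_eq]
    refine Real.sqrt_le_sqrt (Finset.sum_le_sum fun j _ => ?_)
    rw [Real.norm_eq_abs, sq_abs]
    exact pow_le_pow_left₀ (distInt_nonneg _) (distInt_add_le _ _) 2
  rw [h v, h w]
  exact hmono.trans (norm_add_le (WithLp.toLp 2 fun j => distInt (v j))
    (WithLp.toLp 2 fun j => distInt (w j)))

/-- Minkowski's inequality in `L²` for real-valued functions. -/
theorem sqrt_integral_sq_le_add {Ω : Type*} [MeasurableSpace Ω] {μ : Measure Ω}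
    {f g h : Ω → ℝ} (hf : MemLp f 2 μ) (hg : MemLp g 2 μ) (hf0 : ∀ ω, 0 ≤ f ω)
    (hg0 : ∀ ω, 0 ≤ g ω) (hh0 : ∀ ω, 0 ≤ h ω) (hle : ∀ ω, h ω ≤ f ω + g ω) :
    √(∫ ω, h ω ^ 2 ∂μ) ≤ √(∫ ω, f ω ^ 2 ∂μ) + √(∫ ω, g ω ^ 2 ∂μ) := by
  have hf2 := hf.integrable_sq
  have hg2 := hg.integrable_sq
  have hfg : Integrable (fun ω => f ω * g ω) μ := hf.integrable_mul hg
  have hcs : ∫ ω, f ω * g ω ∂μ ≤ √(∫ ω, f ω ^ 2 ∂μ) * √(∫ ω, g ω ^ 2 ∂μ) := by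
    have := integral_mul_le_Lp_mul_Lq_of_nonneg (μ := μ) Real.HolderConjugate.two_two
      (Filter.Eventually.of_forall hf0) (Filter.Eventually.of_forall hg0)
      (by simpa using hf) (by simpa using hg)
    simpa [Real.sqrt_eq_rpow] using this
  have hsum : Integrable (fun ω => f ω ^ 2 + 2 * (f ω * g ω)) μ := hf2.add (hfg.const_mul 2)
  have hle2 : ∫ ω, h ω ^ 2 ∂μ ≤ ∫ ω, (f ω ^ 2 + 2 * (f ω * g ω) + g ω ^ 2) ∂μ := by
    refine integral_mono_of_nonneg (Filter.Eventually.of_forall fun ω => sq_nonneg _)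
      (hsum.add hg2) (Filter.Eventually.of_forall fun ω => ?_)
    have := pow_le_pow_left₀ (hh0 ω) (hle ω) 2
    simp only
    linarith [this, add_sq (f ω) (g ω)]
  rw [integral_add hsum hg2, integral_add hf2 (hfg.const_mul 2),
    integral_const_mul] at hle2
  refine Real.sqrt_le_iff.2 ⟨by positivity, ?_⟩
  have h1 := Real.sq_sqrt (integral_nonneg (μ := μ) fun ω => sq_nonneg (f ω))
  have h2 := Real.sq_sqrt (integral_nonneg (μ := μ) fun ω => sq_nonneg (g ω))
  nlinarith

/-- The Diophantine condition at `ξ y / (2π)`, for `y` below the scale `4 √D`. -/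
theorem distIntVec_lower_bound {n : ℕ} {θ : Fin n → ℝ} {R D ξ y : ℝ} (hR : 1 ≤ R) (hD : 1 ≤ D)
    (hθ : ∀ ξ : ℝ, |ξ| ≤ n →
      (1 / 10) * min |ξ| (((n : ℝ) / R) / |ξ|) ≤ distIntVec (fun j => ξ * θ j))
    (hξ : |ξ| ≤ (n : ℝ) / (R * D)) (hy : y ^ 2 ≤ 16 * D) :
    1 / 100 * min |ξ| (((n : ℝ) / (R * D)) / |ξ|) * |y| ≤
      distIntVec (fun j => ξ * y / (2 * π) * θ j) := by
  have hπ := Real.pi_gt_three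
  have hπ' := Real.pi_lt_four
  set N : ℝ := (n : ℝ) / (R * D) with hN
  have hN0 : 0 ≤ N := by positivity
  have hnR : (n : ℝ) / R = N * D := by rw [hN]; field_simp
  have hnN : N * D ≤ n := hnR ▸ div_le_self (by positivity) hR
  have habs : |ξ * y / (2 * π)| = |ξ| * |y| / (2 * π) := by
    rw [abs_div, abs_mul, abs_of_pos (by positivity : 0 < 2 * π)]
  have hyD : |y| ≤ 4 * D := abs_le_of_sq_le_sq (by nlinarith) (by positivity)
  have ht : |ξ * y / (2 * π)| ≤ n := by
    rw [habs, div_le_iff₀ (by positivity)]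
    calc |ξ| * |y| ≤ N * (4 * D) := by gcongr
      _ ≤ n * (2 * π) := by nlinarith
  refine le_trans ?_ (hθ _ ht)
  rcases eq_or_ne y 0 with rfl | hy0
  · simp
  rcases eq_or_ne ξ 0 with rfl | hξ0
  · simp
  have hy1 : 0 < |y| := abs_pos.2 hy0
  have hξ1 : 0 < |ξ| := abs_pos.2 hξ0
  have key : min |ξ| (N / |ξ|) * |y| / 10 ≤
      min |ξ * y / (2 * π)| ((n : ℝ) / R / |ξ * y / (2 * π)|) := by
    rw [habs, hnR]
    refine le_min ?_ ?_
    · calc min |ξ| (N / |ξ|) * |y| / 10 ≤ |ξ| * |y| / 10 := by gcongr; exact min_le_left _ _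
        _ ≤ |ξ| * |y| / (2 * π) := by
          gcongr
          linarith [Real.pi_lt_d2]
    · calc min |ξ| (N / |ξ|) * |y| / 10 ≤ (N / |ξ|) * |y| / 10 := by
            gcongr; exact min_le_right _ _
        _ = (N / |ξ|) * (y ^ 2 / 10) / |y| := by
          rw [← sq_abs y]; field_simp
        _ ≤ (N / |ξ|) * (2 * π * D) / |y| := by
          gcongr
          nlinarith
        _ = N * D / (|ξ| * |y| / (2 * π)) := by field_simp
  linarith

/-- A nonnegative bound `(a y)²` below the scale `4 √D` survives beyond it after subtracting a
multiple of the fourth moments. -/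
theorem truncated_sq_le {D a d x x' : ℝ} (hD : 0 < D) (ha : 0 ≤ a)
    (h : (x - x') ^ 2 ≤ 16 * D → a * |x - x'| ≤ d) :
    a ^ 2 * ((x - x') ^ 2 - (x ^ 4 + x' ^ 4) / (2 * D)) ≤ d ^ 2 := by
  rcases le_or_gt ((x - x') ^ 2) (16 * D) with hy | hy
  · have h1 := pow_le_pow_left₀ (by positivity) (h hy) 2
    rw [mul_pow, sq_abs] at h1
    have : 0 ≤ (x ^ 4 + x' ^ 4) / (2 * D) := by positivity
    nlinarith [sq_nonneg a]
  · have h4 : (x - x') ^ 4 ≤ 8 * (x ^ 4 + x' ^ 4) := by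
      nlinarith [sq_nonneg (x ^ 2 - x' ^ 2), sq_nonneg (x + x'), sq_nonneg (x - x'),
        mul_nonneg (sq_nonneg (x + x')) (sq_nonneg (x + x')), sq_nonneg (x * x'),
        mul_nonneg (sq_nonneg (x + x')) (sq_nonneg (x - x')),
        mul_nonneg (sq_nonneg (x + x')) (add_nonneg (sq_nonneg x) (sq_nonneg x'))]
    have : (x - x') ^ 2 ≤ (x ^ 4 + x' ^ 4) / (2 * D) := by
      rw [le_div_iff₀ (by positivity)]
      nlinarith [mul_le_mul_of_nonneg_left hy.le (sq_nonneg (x - x'))]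
    exact (mul_nonpos_of_nonneg_of_nonpos (sq_nonneg a) (by linarith)).trans (sq_nonneg d)

theorem memLp_four_of_integrable_pow {Ω : Type*} [MeasurableSpace Ω] {μ : Measure Ω}
    {X : Ω → ℝ} (hX : AEStronglyMeasurable X μ) (h : Integrable (fun ω => X ω ^ 4) μ) :
    MemLp X 4 μ := by
  rw [← integrable_norm_rpow_iff hX (by norm_num) (by norm_num)]
  refine h.congr (Filter.Eventually.of_forall fun ω => ?_)
  have : ((4 : ENNReal).toReal) = ((4 : ℕ) : ℝ) := by norm_num
  simp only [this, Real.rpow_natCast, Real.norm_eq_abs]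
  exact (Even.pow_abs (by decide) _).symm

/-- The truncated second moment of the symmetrization of a standardized variable. -/
theorem integral_sq_sub_fourth {Ω : Type*} [MeasurableSpace Ω] {μ : Measure Ω}
    [IsProbabilityMeasure μ] {X X' : Ω → ℝ} (hX : Measurable X) (hind : IndepFun X X' μ)
    (hid : IdentDistrib X X' μ μ) (h1 : ∫ ω, X ω ∂μ = 0) (h2 : ∫ ω, X ω ^ 2 ∂μ = 1)
    (h4 : Integrable (fun ω => X ω ^ 4) μ) :
    1 ≤ ∫ ω, X ω ^ 4 ∂μ ∧
    Integrable (fun ω => (X ω - X' ω) ^ 2 -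
      (X ω ^ 4 + X' ω ^ 4) / (2 * ∫ ω, X ω ^ 4 ∂μ)) μ ∧
    ∫ ω, ((X ω - X' ω) ^ 2 - (X ω ^ 4 + X' ω ^ 4) / (2 * ∫ ω, X ω ^ 4 ∂μ)) ∂μ = 1 := by
  have hX2 : MemLp X 2 μ :=
    (memLp_four_of_integrable_pow hX.aestronglyMeasurable h4).mono_exponent (by norm_num)
  have hX2' : MemLp X' 2 μ := hid.memLp_iff.1 hX2
  have i1 := hX2.integrable_sq
  have i1' := hX2'.integrable_sq
  have i2 : Integrable (fun ω => X ω * X' ω) μ := hX2.integrable_mul hX2'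
  have id2 : IdentDistrib (fun ω => X ω ^ 2) (fun ω => X' ω ^ 2) μ μ :=
    hid.comp (measurable_id.pow_const 2)
  have id4 : IdentDistrib (fun ω => X ω ^ 4) (fun ω => X' ω ^ 4) μ μ :=
    hid.comp (measurable_id.pow_const 4)
  have h4' := id4.integrable_iff.1 h4
  have hprod : ∫ ω, X ω * X' ω ∂μ = 0 := by
    rw [hind.integral_fun_mul_eq_mul_integral hX2.1 hX2'.1, h1, zero_mul]
  have e2 : ∫ ω, X' ω ^ 2 ∂μ = 1 := id2.integral_eq ▸ h2
  have e4 : ∫ ω, X' ω ^ 4 ∂μ = ∫ ω, X ω ^ 4 ∂μ := id4.integral_eq.symm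
  set D := ∫ ω, X ω ^ 4 ∂μ with hDdef
  have hD : 1 ≤ D := by
    have : ∫ ω, (2 * X ω ^ 2 - 1) ∂μ ≤ D :=
      integral_mono ((i1.const_mul 2).sub (integrable_const 1)) h4 fun ω => by
        nlinarith [sq_nonneg (X ω ^ 2 - 1)]
    rw [integral_sub (i1.const_mul 2) (integrable_const 1), integral_const_mul, h2] at this
    simp at this
    linarith
  have hsq : (fun ω => (X ω - X' ω) ^ 2) = fun ω => X ω ^ 2 - 2 * (X ω * X' ω) + X' ω ^ 2 := by
    funext ω
    ring
  have isq : Integrable (fun ω => (X ω - X' ω) ^ 2) μ := (hX2.sub hX2').integrable_sq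
  have i4 : Integrable (fun ω => (X ω ^ 4 + X' ω ^ 4) / (2 * D)) μ := (h4.add h4').div_const _
  have idiff : Integrable (fun ω => X ω ^ 2 - 2 * (X ω * X' ω)) μ := i1.sub (i2.const_mul 2)
  refine ⟨hD, isq.sub i4, ?_⟩
  rw [integral_sub isq i4, hsq, integral_add idiff i1',
    integral_sub i1 (i2.const_mul 2), integral_const_mul, integral_div, integral_add h4 h4',
    hprod, h2, e2, e4, ← hDdef]
  field_simp
  ring

/-- **Lemma 5.2 (Klartag–Sodin).** For `Y = X − X̃` and `S(ξ) = (E d²(ξY/(2π)·θ, ℤⁿ))^{1/2}`: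
(a) `S` is subadditive; (b) if `R ≥ 1` satisfies the diophantine condition (iii) for `θ`,
then `S(ξ) ≥ c·min{|ξ|, (n/(Rδ⁴))/|ξ|}` for all `|ξ| ≤ n/(Rδ⁴)`. -/
theorem S_subadditive_and_lower_bound :
    ∃ c : ℝ, 0 < c ∧
      ∀ (n : ℕ) (Ω : Type) (_ : MeasureSpace Ω), IsProbabilityMeasure (ℙ : Measure Ω) →
      ∀ X X' : Ω → ℝ,
        Measurable X → Measurable X' →
        IndepFun X X' ℙ → IdentDistrib X X' ℙ ℙ →
        (∫ ω, X ω = 0) →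
        (∫ ω, (X ω) ^ 2 = 1) →
        Integrable (fun ω => (X ω) ^ 4) →
        ∀ θ : Fin n → ℝ, (∑ j, θ j ^ 2) = 1 →
        ∀ S : ℝ → ℝ,
          (∀ ξ, S ξ = Real.sqrt (∫ ω,
              distIntVec (fun j => ξ * (X ω - X' ω) / (2 * π) * θ j) ^ 2)) →
          ((∀ ξ₁ ξ₂ : ℝ, S (ξ₁ + ξ₂) ≤ S ξ₁ + S ξ₂) ∧
            ∀ R : ℝ, 1 ≤ R →
              (∀ ξ : ℝ, |ξ| ≤ n →
                (1 / 10) * min |ξ| (((n : ℝ) / R) / |ξ|) ≤ distIntVec (fun j => ξ * θ j)) →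
              ∀ ξ : ℝ, |ξ| ≤ (n : ℝ) / (R * ∫ ω, (X ω) ^ 4) →
                c * min |ξ| (((n : ℝ) / (R * ∫ ω, (X ω) ^ 4)) / |ξ|) ≤ S ξ) := by
  refine ⟨1 / 100, by norm_num, ?_⟩
  intro n Ω _ _ X X' hX hX' hind hid h1 h2 h4 θ _ S hS
  have hmem (ξ : ℝ) :
      MemLp (fun ω => distIntVec (fun j => ξ * (X ω - X' ω) / (2 * π) * θ j)) 2 ℙ := by
    refine MemLp.of_bound (Measurable.aestronglyMeasurable ?_) (√n)
      (Filter.Eventually.of_forall fun ω => ?_)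
    · exact continuous_distIntVec.measurable.comp (by fun_prop)
    · rw [Real.norm_eq_abs, abs_of_nonneg (distIntVec_nonneg _)]
      exact distIntVec_le_sqrt _
  constructor
  · intro ξ₁ ξ₂
    simp only [hS]
    refine sqrt_integral_sq_le_add (hmem ξ₁) (hmem ξ₂) (fun _ => distIntVec_nonneg _)
      (fun _ => distIntVec_nonneg _) (fun _ => distIntVec_nonneg _) fun ω => ?_
    refine le_of_eq_of_le (congrArg distIntVec (funext fun j => ?_)) (distIntVec_add_le _ _)
    ring
  · intro R hR hθ ξ hξ
    obtain ⟨hD, hint, hval⟩ := integral_sq_sub_fourth hX hind hid h1 h2 h4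
    rw [hS]
    set D := ∫ ω, X ω ^ 4 with hDdef
    set a := 1 / 100 * min |ξ| ((n : ℝ) / (R * D) / |ξ|) with ha
    have ha0 : 0 ≤ a := by positivity
    refine Real.le_sqrt_of_sq_le ?_
    calc a ^ 2 = ∫ ω, a ^ 2 * ((X ω - X' ω) ^ 2 - (X ω ^ 4 + X' ω ^ 4) / (2 * D)) := by
          rw [integral_const_mul, hval, mul_one]
      _ ≤ _ := integral_mono (hint.const_mul _) (hmem ξ).integrable_sq fun ω =>
          truncated_sq_le (by linarith) ha0 (distIntVec_lower_bound hR hD hθ hξ)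
end
end

section
/- There exists a universal constant C > 0 such that the following holds. Let 0 < α < 1 and T ≥ 1, and let f : ℝ → [0,∞) be an even measurable function satisfying f(ξ₁ + ξ₂) ≤ f(ξ₁) + f(ξ₂) for all ξ₁, ξ₂ ∈ ℝ, and f(ξ) ≥ α·min{|ξ|, T/|ξ|} for all ξ with |ξ| ≤ T. Then ∫_{T^{1/6} ≤ |ξ| ≤ T} exp(−f²(ξ))/|ξ| dξ ≤ C/(α⁶·T). -/
open MeasureTheory ProbabilityTheory Real

noncomputable section

/-- A level set `{f ≤ t}` of an even subadditive function `f` with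
`f ξ ≥ α * min |ξ| (T / |ξ|)` meets every interval shorter than `α * T / (2 * t)` in a set of
diameter at most `2 * t / α`; hence its part in `[0, T]` has measure at most `6 * t ^ 2 / α ^ 2`. -/
theorem volume_subadditive_level_set_le {α T t : ℝ} (hα : 0 < α) (hα1 : α < 1) (hT : 1 ≤ T)
    (ht : 1 ≤ t) {f : ℝ → ℝ} (heven : ∀ ξ, f (-ξ) = f ξ)
    (hsub : ∀ ξ₁ ξ₂, f (ξ₁ + ξ₂) ≤ f ξ₁ + f ξ₂)
    (hlow : ∀ ξ : ℝ, |ξ| ≤ T → α * min |ξ| (T / |ξ|) ≤ f ξ) :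
    volume (Set.Icc 0 T ∩ {ξ | f ξ ≤ t}) ≤ ENNReal.ofReal (6 * t ^ 2 / α ^ 2) := by
  have hT0 : 0 < T := by linarith
  have ht0 : 0 < t := by linarith
  set g : ℝ := α * T / (2 * t) with hg
  have hg0 : 0 < g := by positivity
  set N : ℕ := ⌊2 * t / α⌋₊ + 1 with hN
  set J : ℕ → Set ℝ := fun k ↦ {ξ | f ξ ≤ t ∧ k * g ≤ ξ ∧ ξ < (k + 1) * g} with hJ
  have hdiff : ∀ d : ℝ, |d| < g → f d ≤ 2 * t → |d| ≤ 2 * t / α := by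
    intro d hd hfd
    have hgT : g ≤ T := by
      rw [hg, div_le_iff₀ (by positivity)]
      nlinarith
    have h := (hlow d (hd.le.trans hgT)).trans hfd
    rcases le_total |d| (T / |d|) with h' | h'
    · rw [min_eq_left h'] at h
      rw [le_div_iff₀ hα]
      linarith
    · rw [min_eq_right h'] at h
      rcases (abs_nonneg d).eq_or_lt with h0 | h0
      · rw [← h0]; positivity
      · exfalso
        rw [hg, lt_div_iff₀ (by positivity)] at hd
        rw [← mul_div_assoc, div_le_iff₀ h0] at h
        linarith
  have hJvol : ∀ k, volume (J k) ≤ ENNReal.ofReal (2 * t / α) := by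
    intro k
    refine (Real.volume_le_diam _).trans (Metric.ediam_le ?_)
    rintro x ⟨hx, hx1, hx2⟩ y ⟨hy, hy1, hy2⟩
    rw [edist_dist, Real.dist_eq]
    refine ENNReal.ofReal_le_ofReal (hdiff _ ?_ ?_)
    · rw [abs_lt]
      constructor <;> nlinarith
    · have := hsub x (-y)
      rw [heven, ← sub_eq_add_neg] at this
      linarith
  have hcover : Set.Icc 0 T ∩ {ξ | f ξ ≤ t} ⊆ ⋃ k ∈ Finset.range N, J k := by
    rintro x ⟨⟨hx0, hxT⟩, hx⟩
    have hxg : x / g ≤ 2 * t / α := by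
      rw [div_le_div_iff₀ hg0 hα, hg]
      field_simp
      linarith
    simp only [Set.mem_iUnion, Finset.mem_range]
    refine ⟨⌊x / g⌋₊, Nat.lt_succ_of_le (Nat.floor_le_floor hxg), hx, ?_, ?_⟩
    · rw [← le_div_iff₀ hg0]
      exact Nat.floor_le (by positivity)
    · rw [← div_lt_iff₀ hg0]
      exact Nat.lt_floor_add_one _
  have hNle : (N : ℝ) ≤ 3 * t / α := by
    have h1 : (⌊2 * t / α⌋₊ : ℝ) ≤ 2 * t / α := Nat.floor_le (by positivity)
    have h2 : 1 ≤ t / α := by rw [le_div_iff₀ hα]; linarith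
    rw [hN]
    push_cast
    calc _ ≤ 2 * t / α + t / α := by linarith
      _ = _ := by ring
  calc volume (Set.Icc 0 T ∩ {ξ | f ξ ≤ t})
      ≤ ∑ k ∈ Finset.range N, volume (J k) :=
        (measure_mono hcover).trans (measure_biUnion_finset_le _ _)
    _ ≤ ∑ _k ∈ Finset.range N, ENNReal.ofReal (2 * t / α) := Finset.sum_le_sum fun k _ ↦ hJvol k
    _ = ENNReal.ofReal (N * (2 * t / α)) := by
        rw [Finset.sum_const, Finset.card_range, nsmul_eq_mul,
          ENNReal.ofReal_mul (by positivity), ENNReal.ofReal_natCast]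
    _ ≤ ENNReal.ofReal (6 * t ^ 2 / α ^ 2) := by
        refine ENNReal.ofReal_le_ofReal ?_
        calc (N : ℝ) * (2 * t / α) ≤ 3 * t / α * (2 * t / α) := by gcongr
          _ = _ := by field_simp; ring

theorem summable_succ_pow_three_mul_exp_neg :
    Summable fun n : ℕ ↦ ((n : ℝ) + 1) ^ 3 * exp (-(n : ℝ)) := by
  have h := (summable_nat_add_iff 1).2 (Real.summable_pow_mul_exp_neg_nat_mul 3 one_pos)
  refine (h.mul_left (exp 1)).congr fun n ↦ ?_
  push_cast
  rw [mul_left_comm, ← Real.exp_add]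
  ring_nf

theorem lintegral_subadditive_mul_exp_neg_sq_le {α T : ℝ} (hα : 0 < α) (hα1 : α < 1) (hT : 1 ≤ T)
    {f : ℝ → ℝ} (hpos : ∀ ξ, 0 ≤ f ξ) (hf : Measurable f) (heven : ∀ ξ, f (-ξ) = f ξ)
    (hsub : ∀ ξ₁ ξ₂, f (ξ₁ + ξ₂) ≤ f ξ₁ + f ξ₂)
    (hlow : ∀ ξ : ℝ, |ξ| ≤ T → α * min |ξ| (T / |ξ|) ≤ f ξ) :
    ∫⁻ ξ in Set.Icc 0 T, ENNReal.ofReal (f ξ * exp (-(f ξ) ^ 2)) ≤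
      ENNReal.ofReal (6 / α ^ 2 * ∑' n : ℕ, ((n : ℝ) + 1) ^ 3 * exp (-(n : ℝ))) := by
  set A : ℕ → Set ℝ := fun n ↦ {ξ | f ξ ≤ n + 1} with hA
  have hAm : ∀ n, MeasurableSet (A n) := fun n ↦ measurableSet_le hf measurable_const
  set c : ℕ → ℝ := fun n ↦ ((n : ℝ) + 1) * exp (-(n : ℝ)) with hc
  have hpt : ∀ ξ, ENNReal.ofReal (f ξ * exp (-(f ξ) ^ 2)) ≤
      ∑' n, (A n).indicator (fun _ ↦ ENNReal.ofReal (c n)) ξ := by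
    intro ξ
    have hn : (⌊f ξ⌋₊ : ℝ) ≤ f ξ := Nat.floor_le (hpos ξ)
    have hn' : f ξ ≤ ⌊f ξ⌋₊ + 1 := (Nat.lt_floor_add_one _).le
    refine le_trans ?_ (ENNReal.le_tsum ⌊f ξ⌋₊)
    rw [Set.indicator_of_mem (show ξ ∈ A ⌊f ξ⌋₊ from hn')]
    refine ENNReal.ofReal_le_ofReal ?_
    have hsq : (⌊f ξ⌋₊ : ℝ) ≤ (f ξ) ^ 2 := by
      have h1 : (⌊f ξ⌋₊ : ℝ) ≤ (⌊f ξ⌋₊ : ℝ) ^ 2 := by exact_mod_cast Nat.le_self_pow two_ne_zero _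
      exact h1.trans (by gcongr)
    simp only [hc]
    gcongr
  have hsummable : Summable fun n : ℕ ↦ 6 / α ^ 2 * (((n : ℝ) + 1) ^ 3 * exp (-(n : ℝ))) :=
    summable_succ_pow_three_mul_exp_neg.mul_left _
  calc ∫⁻ ξ in Set.Icc 0 T, ENNReal.ofReal (f ξ * exp (-(f ξ) ^ 2))
      ≤ ∫⁻ ξ in Set.Icc 0 T, ∑' n, (A n).indicator (fun _ ↦ ENNReal.ofReal (c n)) ξ :=
        lintegral_mono hpt
    _ = ∑' n, ∫⁻ ξ in Set.Icc 0 T, (A n).indicator (fun _ ↦ ENNReal.ofReal (c n)) ξ :=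
        lintegral_tsum fun n ↦ (measurable_const.indicator (hAm n)).aemeasurable
    _ ≤ ∑' n : ℕ, ENNReal.ofReal (6 / α ^ 2 * (((n : ℝ) + 1) ^ 3 * exp (-(n : ℝ)))) := by
        refine ENNReal.tsum_le_tsum fun n ↦ ?_
        rw [lintegral_indicator_const (hAm n), Measure.restrict_apply (hAm n), Set.inter_comm]
        refine (mul_le_mul_right (volume_subadditive_level_set_le hα hα1 hT
          (by linarith [(Nat.cast_nonneg n : (0 : ℝ) ≤ n)]) heven hsub hlow) _).trans_eq ?_
        rw [← ENNReal.ofReal_mul (by positivity)]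
        congr 1
        simp only [hc]
        ring
    _ = ENNReal.ofReal (6 / α ^ 2 * ∑' n : ℕ, ((n : ℝ) + 1) ^ 3 * exp (-(n : ℝ))) := by
        rw [← ENNReal.ofReal_tsum_of_nonneg (fun n ↦ by positivity) hsummable, tsum_mul_left]

theorem integrable_mul_exp_neg_sq {X : Type*} [MeasurableSpace X] {μ : Measure X}
    [IsFiniteMeasure μ] {f : X → ℝ} (hf : Measurable f) :
    Integrable (fun x ↦ f x * exp (-(f x) ^ 2)) μ := by
  refine Integrable.of_bound (by fun_prop) 1 (Filter.Eventually.of_forall fun x ↦ ?_)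
  rw [Real.norm_eq_abs, abs_mul, abs_of_pos (exp_pos _), Real.exp_neg, ← div_eq_mul_inv,
    div_le_one (exp_pos _)]
  have h := Real.add_one_le_exp ((f x) ^ 2)
  have h' : |f x| ^ 2 = (f x) ^ 2 := sq_abs _
  nlinarith [sq_nonneg (|f x| - 1)]

theorem integral_subadditive_mul_exp_neg_sq_le {α T : ℝ} (hα : 0 < α) (hα1 : α < 1) (hT : 1 ≤ T)
    {f : ℝ → ℝ} (hpos : ∀ ξ, 0 ≤ f ξ) (hf : Measurable f) (heven : ∀ ξ, f (-ξ) = f ξ)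
    (hsub : ∀ ξ₁ ξ₂, f (ξ₁ + ξ₂) ≤ f ξ₁ + f ξ₂)
    (hlow : ∀ ξ : ℝ, |ξ| ≤ T → α * min |ξ| (T / |ξ|) ≤ f ξ) :
    ∫ ξ in Set.Icc 0 T, f ξ * exp (-(f ξ) ^ 2) ≤
      6 / α ^ 2 * ∑' n : ℕ, ((n : ℝ) + 1) ^ 3 * exp (-(n : ℝ)) := by
  have hnn : ∀ ξ, 0 ≤ f ξ * exp (-(f ξ) ^ 2) := fun ξ ↦ mul_nonneg (hpos ξ) (exp_pos _).le
  rw [integral_eq_lintegral_of_nonneg_ae (Filter.Eventually.of_forall hnn) (by fun_prop)]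
  refine ENNReal.toReal_le_of_le_ofReal ?_
    (lintegral_subadditive_mul_exp_neg_sq_le hα hα1 hT hpos hf heven hsub hlow)
  exact mul_nonneg (by positivity) (tsum_nonneg fun n ↦ by positivity)

theorem exp_neg_sq_div_le {α T x y : ℝ} (hα : 0 < α) (hT : 0 < T) (hx : 0 < x)
    (hy : 0 ≤ y) (h : α * min x (T / x) ≤ y) :
    exp (-y ^ 2) / x ≤ 6 / α ^ 6 * x ^ (-7 : ℝ) + 1 / (α * T) * (y * exp (-y ^ 2)) := by
  have hx7 : x ^ (-7 : ℝ) = (x ^ 7)⁻¹ := by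
    rw [Real.rpow_neg hx.le]
    norm_cast
  rw [hx7]
  rcases le_total x (T / x) with h' | h'
  · rw [min_eq_left h'] at h
    refine le_add_of_le_of_nonneg ?_ (by positivity)
    have hexp : exp (-y ^ 2) ≤ 6 / ((α * x) ^ 2) ^ 3 := by
      have h3 : ((α * x) ^ 2) ^ 3 / 6 ≤ exp (y ^ 2) := by
        refine (Real.pow_div_factorial_le_exp _ (by positivity) 3).trans ?_
        gcongr
      rw [Real.exp_neg, inv_le_comm₀ (exp_pos _) (by positivity), inv_div]
      exact h3
    calc exp (-y ^ 2) / x ≤ 6 / ((α * x) ^ 2) ^ 3 / x := by gcongr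
      _ = _ := by field_simp
  · rw [min_eq_right h'] at h
    refine le_add_of_nonneg_of_le (by positivity) ?_
    have hinv : 1 / x ≤ 1 / (α * T) * y := by
      rw [← mul_div_assoc, div_le_iff₀ hx] at h
      rw [one_div_mul_eq_div, div_le_div_iff₀ hx (by positivity)]
      linarith
    calc exp (-y ^ 2) / x = 1 / x * exp (-y ^ 2) := by ring
      _ ≤ 1 / (α * T) * y * exp (-y ^ 2) := by gcongr
      _ = _ := by ring

/-- **Lemma 5.3 (Klartag–Sodin).** If `f ≥ 0` is even, subadditive and satisfies
`f(ξ) ≥ α·min{|ξ|, T/|ξ|}` for `|ξ| ≤ T`, then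
`∫_{T^{1/6} ≤ |ξ| ≤ T} exp(−f²(ξ))/|ξ| dξ ≤ C/(α⁶T)`. -/
theorem subadditive_level_set_integral_bound :
    ∃ C : ℝ, 0 < C ∧
      ∀ (α T : ℝ), 0 < α → α < 1 → 1 ≤ T →
      ∀ f : ℝ → ℝ,
        (∀ ξ, 0 ≤ f ξ) →
        Measurable f →
        (∀ ξ, f (-ξ) = f ξ) →
        (∀ ξ₁ ξ₂, f (ξ₁ + ξ₂) ≤ f ξ₁ + f ξ₂) →
        (∀ ξ : ℝ, |ξ| ≤ T → α * min |ξ| (T / |ξ|) ≤ f ξ) →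
        (∫ ξ in {ξ : ℝ | T ^ ((1 : ℝ) / 6) ≤ |ξ| ∧ |ξ| ≤ T},
            Real.exp (-(f ξ) ^ 2) / |ξ|) ≤ C / (α ^ 6 * T) := by
  set S : ℝ := ∑' n : ℕ, ((n : ℝ) + 1) ^ 3 * exp (-(n : ℝ)) with hS
  have hS0 : 0 ≤ S := tsum_nonneg fun n ↦ by positivity
  refine ⟨2 * (1 + 6 * S), by positivity, ?_⟩
  intro α T hα hα1 hT f hpos hf heven hsub hlow
  have hT0 : 0 < T := by linarith
  set a : ℝ := T ^ ((1 : ℝ) / 6) with ha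
  have ha0 : 0 < a := by positivity
  have ha6 : a ^ (-6 : ℝ) = T⁻¹ := by
    rw [ha, ← Real.rpow_mul hT0.le, ← Real.rpow_neg_one]
    norm_num
  have hfabs : ∀ ξ, f |ξ| = f ξ := fun ξ ↦ by
    rcases abs_choice ξ with h | h <;> rw [h]
    exact heven ξ
  have hsymm : (∫ ξ in {ξ : ℝ | a ≤ |ξ| ∧ |ξ| ≤ T}, exp (-(f ξ) ^ 2) / |ξ|) =
      2 * ∫ ξ in Set.Icc a T, exp (-(f ξ) ^ 2) / ξ := by
    have hm : MeasurableSet {ξ : ℝ | a ≤ |ξ| ∧ |ξ| ≤ T} :=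
      (measurableSet_le measurable_const measurable_norm).inter
        (measurableSet_le measurable_norm measurable_const)
    have h := integral_comp_abs
      (f := (Set.Icc a T).indicator fun ξ ↦ exp (-(f ξ) ^ 2) / ξ)
    have hpos' : Set.Icc a T ⊆ Set.Ioi 0 := fun x hx ↦ ha0.trans_le hx.1
    rw [setIntegral_indicator measurableSet_Icc, Set.inter_eq_self_of_subset_right hpos'] at h
    rw [← h, ← integral_indicator hm]
    congr 1
    ext ξ
    simp only [Set.indicator_apply, Set.mem_Icc, Set.mem_ofPred_eq, hfabs]
  have hint1 : IntegrableOn (fun x : ℝ ↦ x ^ (-7 : ℝ)) (Set.Ici a) := by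
    rw [integrableOn_Ici_iff_integrableOn_Ioi]
    exact integrableOn_Ioi_rpow_of_lt (by norm_num) ha0
  have hI1 : ∫ x in Set.Icc a T, x ^ (-7 : ℝ) ≤ 1 / (6 * T) := by
    calc ∫ x in Set.Icc a T, x ^ (-7 : ℝ) ≤ ∫ x in Set.Ici a, x ^ (-7 : ℝ) := by
          refine setIntegral_mono_set hint1 ?_ Set.Icc_subset_Ici_self.eventuallyLE
          filter_upwards [ae_restrict_mem measurableSet_Ici] with x hx
          exact Real.rpow_nonneg (ha0.le.trans hx) _
      _ = 1 / (6 * T) := by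
          rw [integral_Ici_eq_integral_Ioi, integral_Ioi_rpow_of_lt (by norm_num) ha0,
            show (-7 : ℝ) + 1 = -6 by norm_num, ha6]
          field_simp
  have hint2 : IntegrableOn (fun x : ℝ ↦ f x * exp (-(f x) ^ 2)) (Set.Icc 0 T) :=
    integrable_mul_exp_neg_sq hf
  have hsub' : Set.Icc a T ⊆ Set.Icc 0 T := Set.Icc_subset_Icc_left ha0.le
  have hI2 : ∫ x in Set.Icc a T, f x * exp (-(f x) ^ 2) ≤ 6 / α ^ 2 * S :=
    (setIntegral_mono_set hint2
      (Filter.Eventually.of_forall fun x ↦ mul_nonneg (hpos x) (exp_pos _).le)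
      hsub'.eventuallyLE).trans
      (integral_subadditive_mul_exp_neg_sq_le hα hα1 hT hpos hf heven hsub hlow)
  have hmain : ∫ ξ in Set.Icc a T, exp (-(f ξ) ^ 2) / ξ ≤
      6 / α ^ 6 * (1 / (6 * T)) + 1 / (α * T) * (6 / α ^ 2 * S) := by
    have hi1 := (hint1.mono_set (Set.Icc_subset_Ici_self : Set.Icc a T ⊆ _)).const_mul (6 / α ^ 6)
    have hi2 := (hint2.mono_set hsub').const_mul (1 / (α * T))
    calc ∫ ξ in Set.Icc a T, exp (-(f ξ) ^ 2) / ξ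
        ≤ ∫ ξ in Set.Icc a T, (6 / α ^ 6 * ξ ^ (-7 : ℝ) +
            1 / (α * T) * (f ξ * exp (-(f ξ) ^ 2))) := by
          refine integral_mono_of_nonneg ?_ (hi1.add hi2) ?_
          · filter_upwards [ae_restrict_mem measurableSet_Icc] with x hx
            exact div_nonneg (exp_pos _).le (ha0.le.trans hx.1)
          · filter_upwards [ae_restrict_mem measurableSet_Icc] with x hx
            have hx0 : 0 < x := ha0.trans_le hx.1
            have h := hlow x (by rw [abs_of_pos hx0]; exact hx.2)
            rw [abs_of_pos hx0] at h
            exact exp_neg_sq_div_le hα hT0 hx0 (hpos x) h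
      _ = 6 / α ^ 6 * (∫ x in Set.Icc a T, x ^ (-7 : ℝ)) +
            1 / (α * T) * ∫ x in Set.Icc a T, f x * exp (-(f x) ^ 2) := by
          rw [integral_add hi1 hi2, integral_const_mul, integral_const_mul]
      _ ≤ _ := by gcongr
  have hα3 : α ^ 3 ≤ 1 := pow_le_one₀ hα.le hα1.le
  rw [hsymm]
  calc 2 * ∫ ξ in Set.Icc a T, exp (-(f ξ) ^ 2) / ξ
      ≤ 2 * (6 / α ^ 6 * (1 / (6 * T)) + 1 / (α * T) * (6 / α ^ 2 * S)) := by gcongr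
    _ = 2 * (1 + 6 * S * α ^ 3) / (α ^ 6 * T) := by field_simp
    _ ≤ 2 * (1 + 6 * S * 1) / (α ^ 6 * T) := by gcongr
    _ = 2 * (1 + 6 * S) / (α ^ 6 * T) := by rw [mul_one]
end
end

section
/- There exists a universal constant c > 0 such that the following holds. Let n be a positive integer divisible by four and let θ⁰ ∈ S^{n−1} be the unit vector θ⁰ = (1, √2, −1, −√2, 1, √2, −1, −√2, …)/√(3n/2) (the pattern 1, √2, −1, −√2 repeated n/4 times, normalized). Then for every ξ ∈ ℝ, d(ξθ⁰, ℤⁿ) ≥ min{|ξ|, c·n/|ξ|}. -/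
open MeasureTheory ProbabilityTheory Real

noncomputable section

/-- The 4-periodic pattern `1, √2, −1, −√2, 1, √2, −1, −√2, …`. -/
def pattern4 (k : ℕ) : ℝ :=
  if k % 4 = 0 then 1 else if k % 4 = 1 then Real.sqrt 2
    else if k % 4 = 2 then -1 else -Real.sqrt 2

/-- The explicit unit vector `θ⁰ = (1, √2, −1, −√2, …) / √(3n/2)` (for `4 ∣ n`). -/
def theta0 (n : ℕ) : Fin n → ℝ := fun j => pattern4 j / Real.sqrt (3 * n / 2)

theorem distInt_eq_abs_sub_round (x : ℝ) : distInt x = |x - round x| := by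
  have hbdd : BddBelow (Set.range fun p : ℤ => |(p : ℝ) - x|) :=
    ⟨0, by rintro _ ⟨p, rfl⟩; exact abs_nonneg _⟩
  refine le_antisymm ?_ (le_ciInf fun p => ?_)
  · rw [abs_sub_comm]
    exact ciInf_le hbdd (round x)
  · rw [abs_sub_comm (p : ℝ)]
    exact round_le x p

theorem distInt_neg (x : ℝ) : distInt (-x) = distInt x := by
  unfold distInt
  refine (Equiv.neg ℤ).iInf_congr fun p => ?_
  rw [Equiv.neg_apply, Int.cast_neg, ← abs_neg]
  ring_nf

theorem sum_range_pattern4 (f : ℝ → ℝ) (m : ℕ) :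
    ∑ k ∈ Finset.range (4 * m), f (pattern4 k) =
      m * (f 1 + f (√2) + f (-1) + f (-√2)) := by
  induction m with
  | zero => simp
  | succ m ih =>
    have h0 : pattern4 (4 * m) = 1 := by simp [pattern4]
    have h1 : pattern4 (4 * m + 1) = √2 := by simp [pattern4, Nat.add_mod]
    have h2 : pattern4 (4 * m + 2) = -1 := by simp [pattern4, Nat.add_mod]
    have h3 : pattern4 (4 * m + 3) = -√2 := by simp [pattern4, Nat.add_mod]
    rw [show 4 * (m + 1) = 4 * m + 1 + 1 + 1 + 1 by ring]
    simp only [Finset.sum_range_succ, ih, add_assoc, Nat.reduceAdd, h0, h1, h2, h3]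
    push_cast
    ring

theorem sum_distInt_theta0_sq {n : ℕ} (hn : 4 ∣ n) (ξ : ℝ) :
    ∑ j, distInt (ξ * theta0 n j) ^ 2 =
      n / 2 * (distInt (ξ / √(3 * n / 2)) ^ 2 + distInt (√2 * (ξ / √(3 * n / 2))) ^ 2) := by
  obtain ⟨m, rfl⟩ := hn
  set s := √(3 * ((4 * m : ℕ) : ℝ) / 2) with hs
  have h : ∀ j : Fin (4 * m), distInt (ξ * theta0 (4 * m) j) ^ 2 =
      (fun y => distInt (y * (ξ / s)) ^ 2) (pattern4 j) := fun j => by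
    simp only [theta0, ← hs]
    ring_nf
  simp_rw [h]
  rw [Fin.sum_univ_eq_sum_range (fun k => (fun y => distInt (y * (ξ / s)) ^ 2) (pattern4 k)),
    sum_range_pattern4 fun y => distInt (y * (ξ / s)) ^ 2]
  simp only [neg_mul, distInt_neg, one_mul]
  push_cast
  ring

theorem one_le_sq_sub_two_mul_sq_sq {p q : ℤ} (h : ¬(p = 0 ∧ q = 0)) :
    1 ≤ (q ^ 2 - 2 * p ^ 2) ^ 2 := by
  rw [Order.one_le_iff_pos, sq_pos_iff, sub_ne_zero]
  intro hpq
  have hp : p ≠ 0 := by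
    rintro rfl
    exact h ⟨rfl, by simpa using hpq⟩
  have hp' : (p : ℝ) ≠ 0 := Int.cast_ne_zero.mpr hp
  have hpq' : (q : ℝ) ^ 2 = 2 * p ^ 2 := by exact_mod_cast hpq
  refine irrational_sqrt_two ⟨|(q : ℚ) / p|, ?_⟩
  push_cast
  rw [← Real.sqrt_sq_eq_abs, div_pow, hpq', mul_div_cancel_right₀ _ (pow_ne_zero 2 hp')]

/-- If `t` and `√2 t` do not both round to `0`, they cannot both be close to integers. -/
theorem one_le_mul_dist_sq_of_round_ne_zero {t : ℝ}
    (h : ¬(round t = 0 ∧ round (√2 * t) = 0)) :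
    1 ≤ 96 * t ^ 2 * (distInt t ^ 2 + distInt (√2 * t) ^ 2) := by
  have hone := one_le_sq_sub_two_mul_sq_sq h
  have ht := round_le t 0
  have hrt := round_le (√2 * t) 0
  rw [distInt_eq_abs_sub_round, distInt_eq_abs_sub_round, sq_abs, sq_abs]
  generalize round t = p at *
  generalize round (√2 * t) = q at *
  have hone' : (1 : ℝ) ≤ ((q : ℝ) ^ 2 - 2 * p ^ 2) ^ 2 := by exact_mod_cast hone
  have hr : √2 ^ 2 = 2 := Real.sq_sqrt (by norm_num)
  have hr0 : 0 ≤ √2 := Real.sqrt_nonneg 2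
  rw [Int.cast_zero, sub_zero] at ht hrt
  have hp : |(p : ℝ)| ≤ 2 * |t| := by
    linarith [abs_sub_abs_le_abs_sub (p : ℝ) t, abs_sub_comm (p : ℝ) t]
  have hq : |(q : ℝ)| ≤ 2 * (√2 * |t|) := by
    rw [abs_mul, abs_of_nonneg hr0] at hrt
    have := abs_sub_abs_le_abs_sub (q : ℝ) (√2 * t)
    rw [abs_mul, abs_of_nonneg hr0, abs_sub_comm (q : ℝ)] at this
    linarith
  have hsum : |(q : ℝ) + √2 * p| ≤ 4 * √2 * |t| := by
    have h1 := abs_add_le (q : ℝ) (√2 * p)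
    rw [abs_mul, abs_of_nonneg hr0] at h1
    linarith [mul_le_mul_of_nonneg_left hp hr0]
  have hsum_sq : ((q : ℝ) + √2 * p) ^ 2 ≤ 32 * t ^ 2 := by
    have h1 := pow_le_pow_left₀ (abs_nonneg _) hsum 2
    rw [sq_abs, mul_pow, mul_pow, sq_abs, hr] at h1
    linarith
  have hdiff_sq : ((q : ℝ) - √2 * p) ^ 2 ≤ 3 * ((t - p) ^ 2 + (√2 * t - q) ^ 2) := by
    have h1 := sq_nonneg ((t - p) + √2 * (√2 * t - q))
    linear_combination h1 + ((t - p) ^ 2 + (√2 * t - q) ^ 2) * hr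
  calc (1 : ℝ) ≤ ((q : ℝ) ^ 2 - 2 * p ^ 2) ^ 2 := hone'
    _ = ((q : ℝ) + √2 * p) ^ 2 * ((q : ℝ) - √2 * p) ^ 2 := by
      rw [← mul_pow, ← sq_sub_sq, mul_pow, hr]
    _ ≤ 32 * t ^ 2 * (3 * ((t - p) ^ 2 + (√2 * t - q) ^ 2)) := by gcongr
    _ = _ := by ring

/-- **Lemma 5.5 (Klartag–Sodin).** The explicit vector `θ⁰` satisfies the diophantine
lower bound `d(ξθ⁰, ℤⁿ) ≥ min{|ξ|, c n / |ξ|}` for every real `ξ`. -/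
theorem theta0_diophantine :
    ∃ c : ℝ, 0 < c ∧
      ∀ (n : ℕ), 0 < n → 4 ∣ n →
        ∀ ξ : ℝ, min |ξ| (c * n / |ξ|) ≤ distIntVec (fun j => ξ * theta0 n j) := by
  refine ⟨1 / 16, by norm_num, fun n hn h4 ξ => ?_⟩
  rcases eq_or_ne ξ 0 with rfl | hξ
  · exact (min_le_left _ _).trans (by rw [abs_zero]; exact Real.sqrt_nonneg _)
  have hn' : (0 : ℝ) < n := Nat.cast_pos.mpr hn
  rw [distIntVec, sum_distInt_theta0_sq h4]
  set t := ξ / √(3 * n / 2) with ht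
  have hr : √2 ^ 2 = 2 := Real.sq_sqrt (by norm_num)
  have ht_sq : t ^ 2 = 2 * ξ ^ 2 / (3 * n) := by
    rw [ht, div_pow, Real.sq_sqrt (by positivity)]
    field_simp
  by_cases h : round t = 0 ∧ round (√2 * t) = 0
  · refine (min_le_left _ _).trans (Real.le_sqrt_of_sq_le (le_of_eq ?_))
    rw [distInt_eq_abs_sub_round, distInt_eq_abs_sub_round, h.1, h.2, Int.cast_zero, sub_zero,
      sub_zero, sq_abs, sq_abs, sq_abs, mul_pow, hr, ht_sq]
    field_simp
    norm_num
  · refine (min_le_right _ _).trans (Real.le_sqrt_of_sq_le ?_)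
    have hone := one_le_mul_dist_sq_of_round_ne_zero h
    rw [ht_sq] at hone
    have hξ2 : 0 < ξ ^ 2 := by positivity
    rw [div_pow, sq_abs, div_le_iff₀ hξ2]
    generalize distInt t ^ 2 + distInt (√2 * t) ^ 2 = D at *
    have h1 : (n : ℝ) ≤ 64 * ξ ^ 2 * D := by
      calc (n : ℝ) = n * 1 := (mul_one _).symm
        _ ≤ n * (96 * (2 * ξ ^ 2 / (3 * n)) * D) := by gcongr
        _ = _ := by
          field_simp
          ring
    nlinarith [mul_le_mul_of_nonneg_left h1 hn'.le]
end
end
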